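/- Let L and H be finite-dimensional p-nilpotent restricted Lie algebras over a perfect field F of characteristic p > 0. If u(L) and u(H) are isomorphic as F-algebras, then the restricted Lie algebras L/(L'^p + γ₃(L)) and H/(H'^p + γ₃(H)) are isomorphic (i.e. the quotient L/(L'^p + γ₃(L)) is determined by u(L)). -/

import Mathlib

open UniversalEnvelopingAlgebra

attribute [local instance 100] LieRing.ofAssociativeRing

/-- A restricted Lie algebra over a field `F` of characteristic `p`: a Lie algebra equipped
with a `p`-map `x ↦ x^[p]` satisfying Jacobson's identities.  The additive identity
`(x+y)^[p] = x^[p] + y^[p] + Σ sᵢ(x,y)` (with `sᵢ` the Jacobson polynomials) is expressed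
faithfully inside the universal enveloping algebra, where it reads
`ι((x+y)^[p]) - ι(x^[p]) - ι(y^[p]) = (ι x + ι y)^p - (ι x)^p - (ι y)^p`. -/
class RestrictedLieAlgebra (p : ℕ) (F : Type*) (L : Type*) [Field F]
    [LieRing L] [LieAlgebra F L] : Type _ where
  pOp : L → L
  pOp_smul : ∀ (a : F) (x : L), pOp (a • x) = a ^ p • pOp x
  ad_pOp : ∀ x y : L, ⁅pOp x, y⁆ = ((LieAlgebra.ad F L x) ^ p) y
  pOp_add : ∀ x y : L,
    ι F (pOp (x + y)) - ι F (pOp x) - ι F (pOp y)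
      = (ι F x + ι F y) ^ p - (ι F x) ^ p - (ι F y) ^ p

namespace RestrictedLieAlgebra

variable (p : ℕ) (F : Type*) [Field F]

section Defs

variable (L : Type*) [LieRing L] [LieAlgebra F L] [RestrictedLieAlgebra p F L]

/-- The `p`-map of a restricted Lie algebra. -/
abbrev pmap (x : L) : L := RestrictedLieAlgebra.pOp (p := p) (F := F) x

/-- The relation defining the restricted enveloping algebra as a quotient of the
universal enveloping algebra: `x^p = x^[p]` for all `x ∈ L`. -/
def uRel : UniversalEnvelopingAlgebra F L → UniversalEnvelopingAlgebra F L → Prop :=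
  fun a b => ∃ x : L, a = (ι F x) ^ p ∧ b = ι F (pmap p F L x)

/-- The restricted enveloping algebra `u(L)`: the quotient of the universal enveloping
algebra of `L` by the two-sided ideal generated by `{x^p - x^[p] : x ∈ L}`. -/
abbrev uEnv := RingQuot (uRel p F L)

/-- The canonical (linear) embedding `L → u(L)`. -/
def uemb : L →ₗ[F] uEnv p F L :=
  ((RingQuot.mkAlgHom F (uRel p F L)).toLinearMap).comp (ι F : L →ₗ⁅F⁆ _).toLinearMap

variable [Fact p.Prime]

/-- The augmentation map `ε : u(L) → F`, induced by `x ↦ 0` for `x ∈ L`. -/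
noncomputable def aug : uEnv p F L →ₐ[F] F :=
  RingQuot.liftAlgHom F
    ⟨(UniversalEnvelopingAlgebra.lift F) (0 : L →ₗ⁅F⁆ F), by
      rintro a b ⟨x, rfl, rfl⟩
      simp [UniversalEnvelopingAlgebra.lift_ι_apply,
        zero_pow (Nat.Prime.ne_zero (Fact.out : p.Prime))]⟩

/-- The augmentation ideal `ω(L)`, i.e. the kernel of the augmentation map, as a
subspace of `u(L)`. -/
noncomputable def omegaIdeal : Submodule F (uEnv p F L) :=
  LinearMap.ker (aug p F L).toLinearMap

/-- The image of `L` inside `u(L)`. -/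
def lSub : Submodule F (uEnv p F L) := LinearMap.range (uemb p F L)

end Defs

section Closure

variable {L : Type*} [LieRing L] [LieAlgebra F L] [RestrictedLieAlgebra p F L]

/-- The restricted subalgebra generated by a subset `S` of `L`: the smallest Lie
subalgebra containing `S` which is closed under the `p`-map. -/
def restrictedClosure (S : Set L) : LieSubalgebra F L :=
  sInf {K : LieSubalgebra F L | S ⊆ K ∧ ∀ x ∈ K, pmap p F L x ∈ K}

/-- For a subalgebra `N ⊆ L`, the restricted subalgebra `N^p` generated by all
`x^[p]`, `x ∈ N`. -/
def subPPow (K : LieSubalgebra F L) : LieSubalgebra F L :=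
  restrictedClosure p F (pmap p F L '' K)

end Closure

section PNilpotent

variable (L : Type*) [LieRing L] [LieAlgebra F L] [RestrictedLieAlgebra p F L]

/-- `L` is `p`-nilpotent if `L^{pˢ} = 0` for some `s`, where `L^p` denotes the restricted
subalgebra generated by all `x^[p]`. -/
def IsPNilpotent : Prop :=
  ∃ s : ℕ, (subPPow p F)^[s] (⊤ : LieSubalgebra F L) = ⊥

/-- The derived subalgebra `L' = γ₂(L)` as a submodule of `L`. -/
abbrev derivedSub : Submodule F L := (LieModule.lowerCentralSeries F L L 1).toSubmodule

/-- `L'_p`, the restricted subalgebra generated by `L'`, as a submodule. -/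
def derivedP : Submodule F L :=
  (restrictedClosure p F (derivedSub F L : Set L)).toSubmodule

/-- `L'^p + γ₃(L)`, as a submodule of `L`. -/
def mainIdeal : Submodule F L :=
  (subPPow p F (restrictedClosure p F (derivedSub F L : Set L))).toSubmodule
    ⊔ (LieModule.lowerCentralSeries F L L 2).toSubmodule

end PNilpotent

end RestrictedLieAlgebra

section Jordan

universe u

variable {p : ℕ} {F : Type*} [Field F] [Fact p.Prime] [CharP F p]
  {N : Type u} [AddCommGroup N] [Module F N]

theorem LinearIndependent.sumElim_of_semilinear {α β : Type*}
    (f : N →ₛₗ[frobenius F p] N) {v : α → N} {w : β → N}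
    (hv : LinearIndependent F fun a => f (v a)) (hw : LinearIndependent F w)
    (hfw : ∀ b, f (w b) = 0) : LinearIndependent F (Sum.elim v w) := by
  have key : ∀ c : α →₀ F, f (c.sum fun a r => r • v a) = 0 → c = 0 := by
    intro c hc
    rw [Finsupp.sum, map_sum] at hc
    simp only [LinearMap.map_smulₛₗ, frobenius_def] at hc
    ext a
    by_cases ha : a ∈ c.support
    · have := linearIndependent_iff'.1 hv c.support (fun a => c a ^ p) hc a ha
      simpa using eq_zero_of_pow_eq_zero this
    · simpa using ha
  refine LinearIndependent.sum_type ?_ hw ?_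
  · rw [linearIndependent_iff]
    intro c hc
    refine key c ?_
    rw [Finsupp.linearCombination_apply] at hc
    rw [hc, map_zero]
  · rw [Submodule.disjoint_def]
    intro x hx hx'
    have hker : Submodule.span F (Set.range w) ≤ LinearMap.ker f := by
      rw [Submodule.span_le]
      rintro _ ⟨b, rfl⟩
      exact hfw b
    obtain ⟨c, rfl⟩ := Finsupp.mem_span_range_iff_exists_finsupp.1 hx
    rw [key c (hker hx')]
    simp

variable [PerfectField F]

instance ringHomSurjective_frobenius : RingHomSurjective (frobenius F p) :=
  ⟨surjective_frobenius F p⟩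

theorem exists_chain_basis_of_invariant (f : N →ₛₗ[frobenius F p] N) (k : ℕ) :
    ∀ P : Submodule F N, (∀ x ∈ P, f x ∈ P) → (∀ x ∈ P, f^[k] x = 0) →
      ∃ (I : Type u) (e : I → N) (n : I → ℕ), (∀ i, 0 < n i) ∧ (∀ i, f^[n i] (e i) = 0) ∧
        LinearIndependent F (fun q : {q : I × ℕ // q.2 < n q.1} => f^[q.1.2] (e q.1.1)) ∧
        Submodule.span F
          (Set.range fun q : {q : I × ℕ // q.2 < n q.1} => f^[q.1.2] (e q.1.1)) = P := by
  induction k with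
  | zero =>
    intro P _ hP
    refine ⟨PEmpty, PEmpty.elim, PEmpty.elim, by simp, by simp, ?_, ?_⟩
    · have : IsEmpty {q : PEmpty.{u+1} × ℕ // q.2 < PEmpty.elim q.1} := ⟨fun q => q.1.1.elim⟩
      exact linearIndependent_empty_type
    · have : IsEmpty {q : PEmpty.{u+1} × ℕ // q.2 < PEmpty.elim q.1} := ⟨fun q => q.1.1.elim⟩
      rw [Set.range_eq_empty, Submodule.span_empty, eq_comm, Submodule.eq_bot_iff]
      simpa using hP
  | succ k ih =>
    intro P hfP hP
    have hiter : ∀ j, ∀ x ∈ P, f^[j] x ∈ P := by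
      intro j
      induction j with
      | zero => simp
      | succ j ihj => intro x hx; rw [Function.iterate_succ_apply]; exact ihj _ (hfP x hx)
    obtain ⟨I, e, n, hn, hen, hli, hspan⟩ := ih (P.map f)
      (by rintro _ ⟨x, hx, rfl⟩; exact ⟨f x, hfP x hx, rfl⟩)
      (by rintro _ ⟨x, hx, rfl⟩; rw [← Function.iterate_succ_apply]; exact hP x hx)
    have he : ∀ i, ∃ y ∈ P, f y = e i := by
      intro i
      have : e i ∈ P.map f := by
        rw [← hspan]
        exact Submodule.subset_span ⟨⟨(i, 0), hn i⟩, rfl⟩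
      exact this
    choose e' he'P he' using he
    have hfe' : ∀ j i, f (f^[j] (e' i)) = f^[j] (e i) := by
      intro j i
      rw [← Function.iterate_succ_apply' f, Function.iterate_succ_apply, he']
    -- the last vectors of the lifted chains
    set w : I → N := fun i => f^[n i] (e' i) with hw_def
    have hw_eq : ∀ i, w i = f^[n i - 1] (e i) := by
      intro i
      obtain ⟨m, hm⟩ := Nat.exists_eq_succ_of_ne_zero (hn i).ne'
      simp [hw_def, hm, Function.iterate_succ_apply, he']
    have hw_li : LinearIndependent F w := by
      have := hli.comp (fun i => ⟨(i, n i - 1), Nat.sub_lt (hn i) one_pos⟩)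
        (fun i j hij => by simpa using (congrArg (fun q => q.1.1) hij))
      convert this using 1
      funext i
      exact hw_eq i
    have hfw : ∀ i, f (w i) = 0 := fun i => by rw [hw_def]; simp only; rw [hfe', hen]
    set K : Submodule F N := P ⊓ LinearMap.ker f with hK
    have hwK : Submodule.span F (Set.range w) ≤ K := by
      rw [Submodule.span_le]
      rintro _ ⟨i, rfl⟩
      exact ⟨hiter _ _ (he'P i), hfw i⟩
    obtain ⟨C, hC⟩ := Submodule.exists_isCompl (Submodule.span F (Set.range w))
    set K₂ : Submodule F N := C ⊓ K with hK₂
    have hsup : Submodule.span F (Set.range w) ⊔ K₂ = K := by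
      rw [hK₂, ← sup_inf_assoc_of_le C hwK, hC.sup_eq_top, top_inf_eq]
    let b := Module.Basis.ofVectorSpace F K₂
    have hb_li : LinearIndependent F (fun t => (b t : N)) :=
      b.linearIndependent.map' K₂.subtype (Submodule.ker_subtype _)
    have hb_span : Submodule.span F (Set.range fun t => (b t : N)) = K₂ := by
      have := congrArg (Submodule.map K₂.subtype) b.span_eq
      rw [Submodule.map_span, ← Set.range_comp, Submodule.map_top, Submodule.range_subtype] at this
      exact this
    have hwb : LinearIndependent F (Sum.elim w fun t => (b t : N)) := by
      refine hw_li.sum_type hb_li ?_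
      rw [hb_span]
      exact hC.disjoint.mono_right inf_le_left
    have hall := LinearIndependent.sumElim_of_semilinear f
      (v := fun q : {q : I × ℕ // q.2 < n q.1} => f^[q.1.2] (e' q.1.1))
      (by simpa only [hfe'] using hli) hwb (by
        rintro (i | t)
        · exact hfw i
        · exact (b t).2.2.2)
    refine ⟨I ⊕ Module.Basis.ofVectorSpaceIndex F K₂, Sum.elim e' (fun t => (b t : N)),
      Sum.elim (fun i => n i + 1) (fun _ => 1), ?_, ?_, ?_, ?_⟩
    · rintro (i | t) <;> simp
    · rintro (i | t)
      · simp only [Sum.elim_inl, Function.iterate_succ_apply', hfe', hen]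
      · exact (b t).2.2.2
    · let c : {q : (I ⊕ Module.Basis.ofVectorSpaceIndex F K₂) × ℕ //
          q.2 < Sum.elim (fun i => n i + 1) (fun _ => 1) q.1} →
          {q : I × ℕ // q.2 < n q.1} ⊕ (I ⊕ Module.Basis.ofVectorSpaceIndex F K₂) := fun q =>
        match q with
        | ⟨(Sum.inl i, j), _⟩ => if h : j < n i then Sum.inl ⟨(i, j), h⟩ else Sum.inr (Sum.inl i)
        | ⟨(Sum.inr t, _), _⟩ => Sum.inr (Sum.inr t)
      have hc : Function.Injective c := by
        rintro ⟨⟨i | t, j⟩, h⟩ ⟨⟨i' | t', j'⟩, h'⟩ hcc <;> simp only [c] at hcc <;>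
          simp only [Sum.elim_inl, Sum.elim_inr] at h h'
        · split_ifs at hcc with h1 h2 h2
          · simp only [Sum.inl.injEq, Subtype.mk.injEq, Prod.mk.injEq] at hcc
            obtain ⟨rfl, rfl⟩ := hcc
            rfl
          · simp only [Sum.inr.injEq, Sum.inl.injEq] at hcc
            subst hcc
            have : j = j' := by omega
            subst this
            rfl
        · split_ifs at hcc; simp at hcc
        · split_ifs at hcc; simp at hcc
        · simp only [Sum.inr.injEq] at hcc
          subst hcc
          have : j = j' := by omega
          subst this
          rfl
      convert hall.comp c hc using 1
      funext q
      obtain ⟨⟨i | t, j⟩, h⟩ := q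
      · simp only [Sum.elim_inl] at h
        simp only [c, Function.comp_apply]
        split_ifs with h1
        · rfl
        · have : j = n i := by omega
          subst this
          rfl
      · simp only [Sum.elim_inr, Nat.lt_one_iff] at h
        subst h
        rfl
    · apply le_antisymm
      · rw [Submodule.span_le]
        rintro _ ⟨⟨⟨i | t, j⟩, h⟩, rfl⟩
        · exact hiter _ _ (he'P i)
        · exact hiter _ _ (b t).2.2.1
      · set V := Submodule.span F (Set.range fun q : {q : (I ⊕ Module.Basis.ofVectorSpaceIndex F K₂) × ℕ //
          q.2 < Sum.elim (fun i => n i + 1) (fun _ => 1) q.1} =>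
            f^[q.1.2] (Sum.elim e' (fun t => (b t : N)) q.1.1)) with hV
        have h1 : Submodule.span F
            (Set.range fun q : {q : I × ℕ // q.2 < n q.1} => f^[q.1.2] (e' q.1.1)) ≤ V := by
          rw [Submodule.span_le]
          rintro _ ⟨⟨⟨i, j⟩, h⟩, rfl⟩
          exact Submodule.subset_span ⟨⟨(Sum.inl i, j), Nat.lt_succ_of_lt h⟩, rfl⟩
        have h2 : K ≤ V := by
          rw [← hsup, ← hb_span, sup_le_iff, Submodule.span_le, Submodule.span_le]
          constructor
          · rintro _ ⟨i, rfl⟩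
            exact Submodule.subset_span ⟨⟨(Sum.inl i, n i), Nat.lt_succ_self _⟩, rfl⟩
          · rintro _ ⟨t, rfl⟩
            exact Submodule.subset_span ⟨⟨(Sum.inr t, 0), Nat.one_pos⟩, rfl⟩
        have h3 : P.map f = (Submodule.span F
            (Set.range fun q : {q : I × ℕ // q.2 < n q.1} => f^[q.1.2] (e' q.1.1))).map f := by
          rw [Submodule.map_span, ← Set.range_comp, ← hspan]
          congr 2
          funext q
          exact (hfe' _ _).symm
        have h4 : Submodule.span F
            (Set.range fun q : {q : I × ℕ // q.2 < n q.1} => f^[q.1.2] (e' q.1.1)) ≤ P := by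
          rw [Submodule.span_le]
          rintro _ ⟨q, rfl⟩
          exact hiter _ _ (he'P _)
        intro x hx
        have hfx : f x ∈ P.map f := ⟨x, hx, rfl⟩
        rw [h3] at hfx
        obtain ⟨y, hy, hyx⟩ := hfx
        have hxy : x - y ∈ K := ⟨P.sub_mem hx (h4 hy), by simp [hyx]⟩
        have := V.add_mem (h2 hxy) (h1 hy)
        simpa using this

/-- A nilpotent Frobenius-semilinear map over a perfect field has a Jordan basis. -/
theorem exists_chain_basis (f : N →ₛₗ[frobenius F p] N) (k : ℕ) (hf : ∀ x, f^[k] x = 0) :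
    ∃ (I : Type u) (e : I → N) (n : I → ℕ)
      (b : Module.Basis {q : I × ℕ // q.2 < n q.1} F N),
        (∀ i, f^[n i] (e i) = 0) ∧ ∀ q, b q = f^[q.1.2] (e q.1.1) := by
  obtain ⟨I, e, n, -, hen, hli, hspan⟩ := exists_chain_basis_of_invariant f k ⊤
    (fun _ _ => trivial) (fun x _ => hf x)
  exact ⟨I, e, n, Module.Basis.mk hli hspan.ge, hen, fun q => by simp⟩

end Jordan

section Model

open MvPolynomial

universe u v

variable {p : ℕ} {F : Type v} [Field F]
  {N : Type u} [AddCommGroup N] [Module F N] {I : Type u}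

open Classical in
/-- The value `f^j (e i)` at the exponent of `X i ^ (p ^ j)`, and `0` at every other exponent. -/
noncomputable def chainValue (p : ℕ) (f : N → N) (e : I → N) (m : I →₀ ℕ) : N :=
  if h : ∃ q : I × ℕ, m = Finsupp.single q.1 (p ^ q.2) then
    f^[h.choose.2] (e h.choose.1) else 0

theorem chainValue_single [Fact p.Prime] (f : N → N) (e : I → N) (i : I) (j : ℕ) :
    chainValue p f e (Finsupp.single i (p ^ j)) = f^[j] (e i) := by
  have h : ∃ q : I × ℕ, Finsupp.single i (p ^ j) = Finsupp.single q.1 (p ^ q.2) := ⟨(i, j), rfl⟩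
  have hp : p.Prime := Fact.out
  rw [chainValue, dif_pos h]
  have hc := h.choose_spec
  rw [Finsupp.single_eq_single_iff] at hc
  rcases hc with ⟨h1, h2⟩ | ⟨h1, -⟩
  · rw [← h1, ← Nat.pow_right_injective hp.two_le h2]
  · exact absurd h1 (pow_pos hp.pos j).ne'

theorem chainValue_of_forall_ne (f : N → N) (e : I → N) {m : I →₀ ℕ}
    (h : ∀ i j, m ≠ Finsupp.single i (p ^ j)) : chainValue p f e m = 0 :=
  dif_neg fun ⟨q, hq⟩ => h q.1 q.2 hq

theorem chainValue_smul [Fact p.Prime] [CharP F p] (f : N →ₛₗ[frobenius F p] N) (e : I → N) (m : I →₀ ℕ) :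
    chainValue p f e (p • m) = f (chainValue p f e m) := by
  have hp : p.Prime := Fact.out
  by_cases h : ∃ i j, m = Finsupp.single i (p ^ j)
  · obtain ⟨i, j, rfl⟩ := h
    rw [Finsupp.smul_single, smul_eq_mul, ← pow_succ', chainValue_single, chainValue_single,
      Function.iterate_succ_apply']
  · push Not at h
    rw [chainValue_of_forall_ne f e h, map_zero]
    refine chainValue_of_forall_ne f e fun i j hij => ?_
    have hm : ∀ l, p * m l = Finsupp.single i (p ^ j) l := fun l => by rw [← hij]; rfl
    cases j with
    | zero =>
      have := hm i
      rw [Finsupp.single_eq_same, pow_zero] at this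
      exact hp.one_lt.ne' (Nat.eq_one_of_mul_eq_one_right this)
    | succ j =>
      refine h i j (Finsupp.ext fun l => ?_)
      have := hm l
      refine Nat.eq_of_mul_eq_mul_left hp.pos (this.trans ?_)
      classical
      rw [Finsupp.single_apply, Finsupp.single_apply]
      split_ifs <;> simp [pow_succ']

/-- The linear map sending `X i ^ (p ^ j)` to `f^j (e i)` and every other monomial to `0`. -/
noncomputable def chainMap (F : Type v) [Field F] [Module F N] (p : ℕ) (f : N → N) (e : I → N) :
    MvPolynomial I F →ₗ[F] N :=
  (basisMonomials I F).constr F (chainValue p f e)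

theorem chainMap_monomial (f : N → N) (e : I → N) (m : I →₀ ℕ) (c : F) :
    chainMap F p f e (monomial m c) = c • chainValue p f e m := by
  have h : monomial m c = c • basisMonomials I F m := by
    rw [coe_basisMonomials, smul_monomial, smul_eq_mul, mul_one]
  rw [h, map_smul, chainMap, Module.Basis.constr_basis]

theorem chainMap_pow [Fact p.Prime] [CharP F p] (f : N →ₛₗ[frobenius F p] N) (e : I → N) (a : MvPolynomial I F) :
    chainMap F p f e (a ^ p) = f (chainMap F p f e a) := by
  induction a using MvPolynomial.induction_on' with
  | monomial m c =>
    rw [monomial_pow, chainMap_monomial, chainMap_monomial, chainValue_smul, f.map_smulₛₗ,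
      frobenius_def]
  | add a b ha hb => rw [add_pow_expChar, map_add, map_add, map_add, ha, hb]

theorem chainMap_mul_mem_range [Fact p.Prime] [CharP F p] [PerfectField F]
    (f : N →ₛₗ[frobenius F p] N) (e : I → N)
    {a b : MvPolynomial I F} (ha : coeff 0 a = 0) (hb : coeff 0 b = 0) :
    chainMap F p f e (a * b) ∈ LinearMap.range f := by
  have hp : p.Prime := Fact.out
  rw [a.as_sum, b.as_sum, Finset.sum_mul_sum, map_sum]
  refine Submodule.sum_mem _ fun m hm => ?_
  rw [map_sum]
  refine Submodule.sum_mem _ fun m' hm' => ?_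
  rw [monomial_mul, chainMap_monomial]
  refine Submodule.smul_mem _ _ ?_
  by_cases h : ∃ i j, m + m' = Finsupp.single i (p ^ j)
  · obtain ⟨i, j, hij⟩ := h
    rw [hij, chainValue_single]
    cases j with
    | zero =>
      exfalso
      have hdeg := congrArg Finsupp.degree hij
      rw [map_add, Finsupp.degree_single, pow_zero] at hdeg
      have hm0 : m.degree ≠ 0 := fun h0 => by
        rw [Finsupp.degree_eq_zero_iff] at h0
        subst h0
        exact (mem_support_iff.1 hm) ha
      have hm0' : m'.degree ≠ 0 := fun h0 => by
        rw [Finsupp.degree_eq_zero_iff] at h0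
        subst h0
        exact (mem_support_iff.1 hm') hb
      omega
    | succ j =>
      rw [Function.iterate_succ_apply']
      exact ⟨_, rfl⟩
  · push Not at h
    rw [chainValue_of_forall_ne _ _ h]
    exact Submodule.zero_mem _

/-- The ideal generated by the products of the last elements of the chains with the variables. -/
noncomputable def chainIdeal (F : Type v) [Field F] (p : ℕ) (n : I → ℕ) : Ideal (MvPolynomial I F) :=
  Ideal.span {a | ∃ i j k, n i ≤ j + 1 ∧ a = X i ^ (p ^ j) * X k}

theorem chainMap_eq_zero_of_mem [Fact p.Prime] [CharP F p] (f : N →ₛₗ[frobenius F p] N) (e : I → N) (n : I → ℕ)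
    (hen : ∀ i, f^[n i] (e i) = 0) {a : MvPolynomial I F} (ha : a ∈ chainIdeal F p n) :
    chainMap F p f e a = 0 := by
  have hp : p.Prime := Fact.out
  have hpow : ∀ i j, n i ≤ j → f^[j] (e i) = 0 := by
    intro i j hj
    obtain ⟨c, rfl⟩ := Nat.exists_eq_add_of_le' hj
    rw [Function.iterate_add_apply, hen]
    exact Function.iterate_fixed (map_zero f) c
  refine Submodule.span_induction (p := fun a _ => ∀ g, chainMap F p f e (g * a) = 0)
    ?_ ?_ ?_ ?_ ha 1 |> fun h => by simpa using h
  · rintro _ ⟨i, j, k, hj, rfl⟩ g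
    rw [g.as_sum, Finset.sum_mul, map_sum]
    refine Finset.sum_eq_zero fun m _ => ?_
    rw [X_pow_eq_monomial, X, monomial_mul, monomial_mul, chainMap_monomial]
    by_cases h : ∃ l t, m + (Finsupp.single i (p ^ j) + Finsupp.single k 1)
        = Finsupp.single l (p ^ t)
    · obtain ⟨l, t, hlt⟩ := h
      classical
      have hi := DFunLike.congr_fun hlt i
      have hk := DFunLike.congr_fun hlt k
      have hpj := pow_pos hp.pos j
      simp only [Finsupp.add_apply, Finsupp.single_apply, if_true] at hi hk
      have hil : l = i := by
        by_contra hne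
        rw [if_neg hne] at hi
        omega
      have hkl : l = k := by
        by_contra hne
        rw [if_neg hne] at hk
        omega
      subst hil
      subst hkl
      simp only [if_true] at hi
      have hjt : j < t := (Nat.pow_lt_pow_iff_right hp.one_lt).1 (by omega)
      rw [hlt, chainValue_single, hpow _ _ (by omega), smul_zero]
    · push Not at h
      rw [chainValue_of_forall_ne _ _ h, smul_zero]
  · simp
  · intro a b _ _ ha hb g
    rw [mul_add, map_add, ha, hb, add_zero]
  · intro c a _ ha g
    rw [smul_eq_mul, ← mul_assoc, ha]

theorem mul_X_pow_mem_chainIdeal (n : I → ℕ) {a : MvPolynomial I F} (ha : coeff 0 a = 0)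
    {i : I} {j : ℕ} (hj : n i ≤ j + 1) : a * X i ^ (p ^ j) ∈ chainIdeal F p n := by
  rw [a.as_sum, Finset.sum_mul]
  refine Ideal.sum_mem _ fun m hm => ?_
  have hm0 : m ≠ 0 := by
    rintro rfl
    exact (mem_support_iff.1 hm) ha
  obtain ⟨k, hk⟩ := Finsupp.ne_iff.1 hm0
  have hmk : m = (m - Finsupp.single k 1) + Finsupp.single k 1 := by
    refine (tsub_add_cancel_of_le ?_).symm
    rw [Finsupp.single_le_iff]
    exact Nat.one_le_iff_ne_zero.2 hk
  rw [hmk, ← mul_one (coeff _ a), ← monomial_mul, mul_assoc, mul_comm (monomial (Finsupp.single k 1) 1)]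
  exact Ideal.mul_mem_left _ _ (Ideal.subset_span ⟨i, j, k, hj, rfl⟩)

/-- A vector space `N` with a nilpotent Frobenius-semilinear endomorphism `f` over a perfect field
is a Frobenius-equivariant retract of the augmentation ideal of a commutative algebra in which the
kernel of `f` annihilates the augmentation ideal. -/
theorem exists_frobenius_model [Fact p.Prime] [CharP F p] [PerfectField F]
    (f : N →ₛₗ[frobenius F p] N) (k : ℕ)
    (hf : ∀ x, f^[k] x = 0) :
    ∃ (R : Type (max u v)) (_ : CommRing R) (_ : Algebra F R) (ε : R →ₐ[F] F) (ρ : R →ₗ[F] N)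
      (s : N →ₗ[F] R), (∀ x, ρ (s x) = x) ∧ ρ 1 = 0 ∧ (∀ x, ε (s x) = 0) ∧
      (∀ a z, ε a = 0 → f z = 0 → a * s z = 0) ∧ (∀ x, s (f x) = s x ^ p) ∧
      (∀ a b, ε a = 0 → ε b = 0 → ρ (a * b) ∈ LinearMap.range f) ∧
      (∀ a, ρ (a ^ p) = f (ρ a)) := by
  have hp : p.Prime := Fact.out
  classical
  obtain ⟨I, e, n, b, hen, hb⟩ := exists_chain_basis f k hf
  let W := chainIdeal F p n
  let R := MvPolynomial I F ⧸ W
  let mk : MvPolynomial I F →ₐ[F] R := Ideal.Quotient.mkₐ F W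
  have hmk : Function.Surjective mk := Ideal.Quotient.mkₐ_surjective F W
  have hmk0 : ∀ a ∈ W, mk a = 0 := fun a ha => Ideal.Quotient.eq_zero_iff_mem.2 ha
  let ε : R →ₐ[F] F := Ideal.Quotient.liftₐ W (aeval fun _ => (0 : F)) (by
    intro a ha
    refine Submodule.span_induction ?_ (by simp) (fun a b _ _ ha hb => by rw [map_add, ha, hb, add_zero])
      (fun c a _ ha => by rw [smul_eq_mul, map_mul, ha, mul_zero]) ha
    rintro _ ⟨i, j, k, -, rfl⟩
    simp)
  have hε : ∀ a, ε (mk a) = coeff 0 a := by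
    intro a
    have : ε (mk a) = aeval (fun _ => (0 : F)) a := rfl
    rw [this, aeval_zero', constantCoeff_eq, Algebra.algebraMap_self, RingHom.id_apply]
  let ρ : R →ₗ[F] N := (Submodule.liftQ (W.restrictScalars F) (chainMap F p f e)
      fun a ha => chainMap_eq_zero_of_mem f e n hen ha) ∘ₗ
    (Submodule.Quotient.restrictScalarsEquiv F W).symm.toLinearMap
  have hρ : ∀ a, ρ (mk a) = chainMap F p f e a := fun a => rfl
  let s : N →ₗ[F] R := b.constr F fun q => mk (X q.1.1 ^ (p ^ q.1.2))
  have hs : ∀ q, s (b q) = mk (X q.1.1 ^ (p ^ q.1.2)) := fun q => b.constr_basis F _ q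
  have hfb : ∀ q : {q : I × ℕ // q.2 < n q.1}, ∀ h : q.1.2 + 1 < n q.1.1,
      f (b q) = b ⟨(q.1.1, q.1.2 + 1), h⟩ := fun q h => by
    rw [hb, hb, Function.iterate_succ_apply']
  have hfb0 : ∀ q : {q : I × ℕ // q.2 < n q.1}, ¬ q.1.2 + 1 < n q.1.1 → f (b q) = 0 := by
    intro q h
    have hq : n q.1.1 = q.1.2 + 1 := by have := q.2; omega
    rw [hb, ← Function.iterate_succ_apply' f, ← Nat.add_one, ← hq, hen]
  have : Nontrivial R := ε.toRingHom.domain_nontrivial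
  have : ExpChar R p := expChar_of_injective_algebraMap (algebraMap F R).injective p
  refine ⟨R, inferInstance, inferInstance, ε, ρ, s, ?_, ?_, ?_, ?_, ?_, ?_, ?_⟩
  · intro x
    refine LinearMap.congr_fun (f := ρ ∘ₗ s) (g := LinearMap.id) (b.ext fun q => ?_) x
    rw [LinearMap.comp_apply, hs, hρ, X_pow_eq_monomial, chainMap_monomial, chainValue_single,
      one_smul, hb, LinearMap.id_apply]
  · rw [← map_one mk, hρ, ← C_1, ← monomial_zero', chainMap_monomial, chainValue_of_forall_ne,
      smul_zero]
    intro i j h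
    exact (pow_pos hp.pos j).ne' (Finsupp.single_eq_zero.1 h.symm)
  · intro x
    refine LinearMap.congr_fun (f := ε.toLinearMap ∘ₗ s) (g := 0) (b.ext fun q => ?_) x
    rw [LinearMap.comp_apply, hs, AlgHom.toLinearMap_apply, hε, X_pow_eq_monomial, coeff_monomial,
      if_neg, LinearMap.zero_apply]
    exact fun h => (pow_pos hp.pos _).ne' (Finsupp.single_eq_zero.1 h)
  · intro a z ha hz
    obtain ⟨a, rfl⟩ := hmk a
    rw [hε] at ha
    have hcoord : ∀ y : N, ∀ q : {q : I × ℕ // q.2 < n q.1}, ∀ h : q.1.2 + 1 < n q.1.1,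
        b.repr (f y) ⟨(q.1.1, q.1.2 + 1), h⟩ = b.repr y q ^ p := by
      intro y q h
      induction (b.mem_span y) using Submodule.span_induction with
      | mem y hy =>
        obtain ⟨q', rfl⟩ := hy
        by_cases h' : q'.1.2 + 1 < n q'.1.1
        · rw [hfb q' h', b.repr_self, b.repr_self, Finsupp.single_apply, Finsupp.single_apply]
          have : (⟨(q'.1.1, q'.1.2 + 1), h'⟩ : {q : I × ℕ // q.2 < n q.1})
              = ⟨(q.1.1, q.1.2 + 1), h⟩ ↔ q' = q := by
            rw [Subtype.ext_iff, Subtype.ext_iff, Prod.ext_iff, Prod.ext_iff]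
            simp
          simp only [this]
          split_ifs <;> simp [hp.ne_zero]
        · rw [hfb0 q' h', b.repr_self, Finsupp.single_apply, if_neg]
          · simp [hp.ne_zero]
          · rintro rfl
            exact h' h
      | zero => simp [hp.ne_zero]
      | add x y _ _ hx hy =>
        rw [map_add, map_add, map_add, Finsupp.add_apply, Finsupp.add_apply, hx, hy,
          add_pow_expChar]
      | smul c x _ hx =>
        rw [f.map_smulₛₗ, map_smul, map_smul, Finsupp.smul_apply, Finsupp.smul_apply, hx,
          smul_eq_mul, smul_eq_mul, mul_pow, frobenius_def]
    rw [← b.linearCombination_repr z, Finsupp.linearCombination_apply, Finsupp.sum, map_sum,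
      Finset.mul_sum]
    refine Finset.sum_eq_zero fun q _ => ?_
    by_cases h : q.1.2 + 1 < n q.1.1
    · have hq := hcoord z q h
      rw [hz, map_zero, Finsupp.zero_apply] at hq
      rw [eq_zero_of_pow_eq_zero hq.symm, zero_smul, map_zero, mul_zero]
    · rw [map_smul, mul_smul_comm, hs, ← map_mul,
        hmk0 _ (mul_X_pow_mem_chainIdeal n ha (not_lt.1 h)), smul_zero]
  · intro x
    induction (b.mem_span x) using Submodule.span_induction with
    | mem y hy =>
      obtain ⟨q, rfl⟩ := hy
      rw [hs, ← map_pow, ← pow_mul, ← pow_succ]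
      by_cases h : q.1.2 + 1 < n q.1.1
      · rw [hfb q h, hs]
      · rw [hfb0 q h, map_zero, eq_comm]
        apply hmk0
        have hpq : p ^ (q.1.2 + 1) = (p ^ (q.1.2 + 1) - p ^ q.1.2) + p ^ q.1.2 :=
          (Nat.sub_add_cancel (Nat.pow_le_pow_right hp.pos (Nat.le_succ _))).symm
        rw [hpq, pow_add]
        refine mul_X_pow_mem_chainIdeal n ?_ (not_lt.1 h)
        rw [X_pow_eq_monomial, coeff_monomial, if_neg]
        intro h0
        have := Finsupp.single_eq_zero.1 h0
        have := Nat.pow_lt_pow_right hp.one_lt (Nat.lt_add_one q.1.2)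
        omega
    | zero => simp [hp.ne_zero]
    | add x y _ _ hx hy => rw [map_add, map_add, map_add, hx, hy, add_pow_expChar]
    | smul c x _ hx => rw [f.map_smulₛₗ, map_smul, map_smul, hx, smul_pow, frobenius_def]
  · intro a c ha hc
    obtain ⟨a, rfl⟩ := hmk a
    obtain ⟨c, rfl⟩ := hmk c
    rw [hε] at ha hc
    rw [← map_mul, hρ]
    exact chainMap_mul_mem_range f e ha hc
  · intro a
    obtain ⟨a, rfl⟩ := hmk a
    rw [← map_pow, hρ, hρ, chainMap_pow]

end Model

namespace RestrictedLieAlgebra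

section Retraction

universe u v w

variable {p : ℕ} {F : Type v} [Field F]

section UEnv

variable {L : Type w} [LieRing L] [LieAlgebra F L] [RestrictedLieAlgebra p F L]

@[elab_as_elim]
theorem uEnv_induction {motive : uEnv p F L → Prop}
    (algebraMap : ∀ c : F, motive (algebraMap F _ c)) (uemb : ∀ x, motive (uemb p F L x))
    (mul : ∀ a b, motive a → motive b → motive (a * b))
    (add : ∀ a b, motive a → motive b → motive (a + b)) (u : uEnv p F L) : motive u := by
  obtain ⟨u, rfl⟩ := RingQuot.mkAlgHom_surjective F (uRel p F L) u
  obtain ⟨t, rfl⟩ : ∃ t, UniversalEnvelopingAlgebra.mkAlgHom F L t = u := Quotient.exists_rep u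
  induction t using TensorAlgebra.induction with
  | algebraMap c => rw [AlgHom.commutes, AlgHom.commutes]; exact algebraMap c
  | ι x => exact uemb x
  | mul a b ha hb => rw [map_mul, map_mul]; exact mul _ _ ha hb
  | add a b ha hb => rw [map_add, map_add]; exact add _ _ ha hb

theorem uemb_lie (x y : L) :
    uemb p F L ⁅x, y⁆ = uemb p F L x * uemb p F L y - uemb p F L y * uemb p F L x := by
  simp only [uemb, LinearMap.comp_apply, AlgHom.toLinearMap_apply, LieHom.coe_toLinearMap,
    LieHom.map_lie, LieRing.of_associative_ring_bracket, map_sub, map_mul]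

theorem uemb_pmap (x : L) : uemb p F L (pmap p F L x) = uemb p F L x ^ p := by
  have h : uRel p F L (ι F x ^ p) (ι F (pmap p F L x)) := ⟨x, rfl, rfl⟩
  have := RingQuot.mkAlgHom_rel F h
  rw [map_pow] at this
  exact this.symm

theorem aug_uemb [Fact p.Prime] (x : L) : aug p F L (uemb p F L x) = 0 := by
  have : aug p F L (uemb p F L x)
      = UniversalEnvelopingAlgebra.lift F (0 : L →ₗ⁅F⁆ F) (ι F x) :=
    RingQuot.liftAlgHom_mkAlgHom_apply _ _ _ _
  rw [this, lift_ι_apply, LieHom.zero_apply]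

/-- A restricted representation of `L` extends to `u(L)`. -/
theorem exists_uEnv_lift {A : Type*} [Ring A] [Algebra F A] (θ : L →ₗ[F] A)
    (hlie : ∀ x y, θ ⁅x, y⁆ = θ x * θ y - θ y * θ x) (hp : ∀ x, θ (pmap p F L x) = θ x ^ p) :
    ∃ Θ : uEnv p F L →ₐ[F] A, ∀ x, Θ (uemb p F L x) = θ x := by
  let θ' : L →ₗ⁅F⁆ A := { θ with
    map_lie' := fun {x y} => by
      rw [LieRing.of_associative_ring_bracket]
      exact hlie x y }
  refine ⟨RingQuot.liftAlgHom F ⟨UniversalEnvelopingAlgebra.lift F θ', ?_⟩, fun x => ?_⟩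
  · rintro _ _ ⟨x, rfl, rfl⟩
    rw [map_pow, lift_ι_apply, lift_ι_apply]
    exact (hp x).symm
  · refine (RingQuot.liftAlgHom_mkAlgHom_apply _ _ _ _).trans ?_
    exact lift_ι_apply F θ' x

end UEnv

/-- A bilinear map `B` and a Frobenius-semilinear nilpotent map `f` on `N` encoding a restricted
Lie algebra of nilpotency class at most two, with bracket `B x y - B y x`, whose derived subalgebra
is killed by the `p`-map. -/
structure FrobeniusTwist (p : ℕ) (F : Type v) (N : Type u) [Field F] [Fact p.Prime] [CharP F p]
    [AddCommGroup N] [Module F N] where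
  B : N →ₗ[F] N →ₗ[F] N
  f : N →ₛₗ[frobenius F p] N
  B_B_left : ∀ x y z, B (B x y) z = 0
  B_B_right : ∀ x y z, B x (B y z) = 0
  B_f_left : ∀ x y, B (f x) y = 0
  B_f_right : ∀ x y, B x (f y) = 0
  f_B : ∀ x y, f (B x y) = 0
  exists_iterate_eq_zero : ∃ k, ∀ x, f^[k] x = 0
  B_mem : ∀ x y, B x y ∈ Submodule.span F {z | ∃ x y, B x y - B y x = z}

namespace FrobeniusTwist

variable [Fact p.Prime] [CharP F p] {N : Type u} [AddCommGroup N] [Module F N]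
  (t : FrobeniusTwist p F N)

/-- The Lie bracket of a Frobenius twist. -/
def br (x y : N) : N := t.B x y - t.B y x

/-- The `p`-map of a Frobenius twist. -/
def pw (x : N) : N := t.f x + if p = 2 then t.B x x else 0

/-- The derived subalgebra of a Frobenius twist. -/
def derived : Submodule F N := Submodule.span F {z | ∃ x y, t.br x y = z}

/-- Restricted Lie algebra homomorphisms from `L` into a Frobenius twist. -/
structure IsRestrictedHom {L : Type w} [LieRing L] [LieAlgebra F L] [RestrictedLieAlgebra p F L]
    (π : L →ₗ[F] N) : Prop where
  map_lie : ∀ x y, π ⁅x, y⁆ = t.br (π x) (π y)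
  map_pmap : ∀ x, π (pmap p F L x) = t.pw (π x)

variable {L : Type w} [LieRing L] [LieAlgebra F L] [RestrictedLieAlgebra p F L]
  [PerfectField F]

/-- A restricted homomorphism from `L` to a Frobenius twist extends to a linear map on `u(L)` which
is a homomorphism of restricted Lie algebras on the augmentation ideal. -/
theorem exists_extension {π : L →ₗ[F] N} (hπ : t.IsRestrictedHom π) :
    ∃ ρ : uEnv p F L →ₗ[F] N, (∀ x, ρ (uemb p F L x) = π x) ∧
      (∀ u v, aug p F L u = 0 → aug p F L v = 0 → ρ (u * v - v * u) = t.br (ρ u) (ρ v)) ∧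
      (∀ u v, aug p F L u = 0 → aug p F L v = 0 →
        ρ (u * v) ∈ t.derived ⊔ LinearMap.range t.f) ∧
      (∀ u, aug p F L u = 0 → ρ (u ^ p) = t.pw (ρ u)) := by
  have hp : p.Prime := Fact.out
  obtain ⟨k, hk⟩ := t.exists_iterate_eq_zero
  obtain ⟨R, _, _, ε, ρ, s, hρs, hρ1, hεs, hann, hsf, hmul, hpow⟩ :=
    exists_frobenius_model t.f k hk
  have hBmul : ∀ a b, ε a = 0 → ε b = 0 → ∀ x, t.B (ρ (a * b)) x = 0 ∧ t.B x (ρ (a * b)) = 0 := by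
    intro a b ha hb x
    obtain ⟨y, hy⟩ := hmul a b ha hb
    rw [← hy]
    exact ⟨t.B_f_left _ _, t.B_f_right _ _⟩
  have hannB : ∀ a x y, ε a = 0 → a * s (t.B x y) = 0 := fun a x y ha => hann a _ ha (t.f_B x y)
  let T : R →ₗ[F] Module.End F R := LinearMap.mk₂ F (fun r g => r * g + s (t.B (ρ r) (ρ g)))
    (fun a b g => by simp only [map_add, add_mul, LinearMap.add_apply]; abel)
    (fun c a g => by simp only [map_smul, smul_mul_assoc, LinearMap.smul_apply, smul_add])
    (fun a g h => by simp only [map_add, mul_add]; abel)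
    (fun c a g => by simp only [map_smul, mul_smul_comm, smul_add])
  have hT : ∀ a g, T a g = a * g + s (t.B (ρ a) (ρ g)) := fun a g => rfl
  have hT1 : ∀ a, T a 1 = a := fun a => by rw [hT, hρ1, map_zero, map_zero, mul_one, add_zero]
  have hTT : ∀ a b, ε a = 0 → ε b = 0 → T a * T b = T (a * b + s (t.B (ρ a) (ρ b))) := by
    intro a b ha hb
    ext g
    obtain ⟨c, g', hg', rfl⟩ : ∃ (c : F) (g' : R), ε g' = 0 ∧ g = algebraMap F R c + g' :=
      ⟨ε g, g - algebraMap F R (ε g), by simp, by simp⟩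
    have h1 := hBmul b g' hb hg'
    have h2 := hBmul a b ha hb
    have h3 : ρ (algebraMap F R c) = 0 := by
      rw [Algebra.algebraMap_eq_smul_one, map_smul, hρ1, smul_zero]
    have h4 : s (t.B (ρ a) (ρ b)) * g' = 0 := by rw [mul_comm, hannB _ _ _ hg']
    have h5 : t.B (ρ a) (ρ (b * algebraMap F R c)) = c • t.B (ρ a) (ρ b) := by
      rw [mul_comm, ← Algebra.smul_def, map_smul, map_smul]
    simp only [Module.End.mul_apply, hT, map_add, mul_add, hannB _ _ _ ha, h3,
      (h1 _).2, (h2 _).1, hρs, t.B_B_left, t.B_B_right, h4, h5, map_zero, add_zero,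
      LinearMap.add_apply, map_smul]
    rw [Algebra.smul_def]
    ring
  have hTpow : ∀ a, ε a = 0 → ∀ n, 1 ≤ n →
      T a ^ n = T (a ^ n + if n = 2 then s (t.B (ρ a) (ρ a)) else 0) := by
    intro a ha n hn
    induction n, hn using Nat.le_induction with
    | base => simp
    | succ n hn ih =>
      have hεn : ε (a ^ n) = 0 := by rw [map_pow, ha, zero_pow (by omega)]
      have hε' : ε (a ^ n + if n = 2 then s (t.B (ρ a) (ρ a)) else 0) = 0 := by
        rw [map_add, hεn]
        split_ifs <;> simp [hεs]
      rw [pow_succ, ih, hTT _ _ hε' ha]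
      congr 1
      rcases hn.eq_or_lt with rfl | hn2
      · simp [pow_two]
      · have h1 : ρ (a ^ n) = ρ (a ^ (n - 1) * a) := by rw [← pow_succ, Nat.sub_add_cancel hn]
        have h2 : ε (a ^ (n - 1)) = 0 := by rw [map_pow, ha, zero_pow (by omega)]
        have h3 : n + 1 ≠ 2 := by omega
        rw [if_neg h3, map_add, map_add, h1, LinearMap.add_apply, (hBmul _ _ h2 ha _).1, add_mul,
          ← pow_succ]
        split_ifs with h
        · rw [mul_comm _ a, hannB _ _ _ ha, hρs, t.B_B_left]
          simp
        · simp
  obtain ⟨Θ, hΘ⟩ := exists_uEnv_lift (p := p) (T ∘ₗ s ∘ₗ π)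
    (by
      intro x y
      simp only [LinearMap.comp_apply]
      rw [hTT _ _ (hεs _) (hεs _), hTT _ _ (hεs _) (hεs _), ← map_sub, hπ.map_lie, br, hρs, hρs,
        map_sub, mul_comm (s (π x))]
      congr 1
      abel)
    (by
      intro x
      simp only [LinearMap.comp_apply]
      rw [hTpow _ (hεs _) p hp.one_le, hπ.map_pmap, pw, map_add, hsf, hρs]
      congr 2
      split_ifs <;> simp)
  have hΘT : ∀ u, ∃ a, ε a = 0 ∧ Θ u = algebraMap F _ (aug p F L u) + T a := by
    intro u
    induction u using uEnv_induction with
    | algebraMap c => exact ⟨0, map_zero _, by simp⟩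
    | uemb x => exact ⟨s (π x), hεs _, by rw [hΘ, aug_uemb]; simp⟩
    | mul u v hu hv =>
      obtain ⟨a, ha, hu⟩ := hu
      obtain ⟨b, hb, hv⟩ := hv
      refine ⟨aug p F L u • b + aug p F L v • a + (a * b + s (t.B (ρ a) (ρ b))), ?_, ?_⟩
      · simp [ha, hb, hεs]
      · rw [map_mul, map_mul, hu, hv, add_mul, mul_add, mul_add, hTT a b ha hb,
          Algebra.algebraMap_eq_smul_one, Algebra.algebraMap_eq_smul_one,
          Algebra.algebraMap_eq_smul_one]
        simp only [map_add, map_smul, smul_mul_assoc, one_mul, mul_smul_comm, mul_one, smul_smul]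
        rw [mul_comm (aug p F L v)]
        abel
    | add u v hu hv =>
      obtain ⟨a, ha, hu⟩ := hu
      obtain ⟨b, hb, hv⟩ := hv
      refine ⟨a + b, by simp [ha, hb], ?_⟩
      rw [map_add, map_add, hu, hv, map_add, map_add]
      abel
  have hΘ0 : ∀ u, aug p F L u = 0 → ∃ a, ε a = 0 ∧ Θ u = T a := by
    intro u hu
    obtain ⟨a, ha, h⟩ := hΘT u
    exact ⟨a, ha, by rw [h, hu, map_zero, zero_add]⟩
  refine ⟨ρ ∘ₗ LinearMap.applyₗ (1 : R) ∘ₗ Θ.toLinearMap, ?_, ?_, ?_, ?_⟩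
  · intro x
    simp only [LinearMap.comp_apply, AlgHom.toLinearMap_apply, hΘ, LinearMap.applyₗ_apply_apply,
      hT1, hρs]
  · intro u v hu hv
    obtain ⟨a, ha, hu⟩ := hΘ0 u hu
    obtain ⟨b, hb, hv⟩ := hΘ0 v hv
    simp only [LinearMap.comp_apply, AlgHom.toLinearMap_apply, LinearMap.applyₗ_apply_apply,
      map_sub, map_mul, hu, hv, hTT a b ha hb, hTT b a hb ha, hT1, map_add,
      hρs, br, mul_comm b a]
    abel
  · intro u v hu hv
    obtain ⟨a, ha, hu⟩ := hΘ0 u hu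
    obtain ⟨b, hb, hv⟩ := hΘ0 v hv
    simp only [LinearMap.comp_apply, AlgHom.toLinearMap_apply, LinearMap.applyₗ_apply_apply,
      map_mul, hu, hv, hTT a b ha hb, hT1, map_add, hρs]
    exact Submodule.add_mem _ (Submodule.mem_sup_right (hmul a b ha hb))
      (Submodule.mem_sup_left (t.B_mem _ _))
  · intro u hu
    obtain ⟨a, ha, hu⟩ := hΘ0 u hu
    simp only [LinearMap.comp_apply, AlgHom.toLinearMap_apply, LinearMap.applyₗ_apply_apply,
      map_pow, hu, hTpow a ha p hp.one_le, hT1, map_add, hpow, pw]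
    congr 1
    split_ifs <;> simp [hρs]

end FrobeniusTwist

end Retraction

section Twist

/-- Over a field, every alternating bilinear map is the antisymmetrization of a bilinear map. -/
theorem _root_.LinearMap.exists_sub_flip_eq {F V N : Type*} [Field F] [AddCommGroup V]
    [Module F V] [AddCommGroup N] [Module F N] {ω : V →ₗ[F] V →ₗ[F] N} (hω : ∀ v, ω v v = 0) :
    ∃ B : V →ₗ[F] V →ₗ[F] N, (∀ v w, B v w - B w v = ω v w) ∧
      ∀ v w, B v w ∈ Submodule.span F {z | ∃ v w, ω v w = z} := by
  classical
  let b := Module.Basis.ofVectorSpace F V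
  let _ := linearOrderOfSTO (WellOrderingRel (α := Module.Basis.ofVectorSpaceIndex F V))
  let B : V →ₗ[F] V →ₗ[F] N :=
    b.constr F fun i => b.constr F fun j => if i < j then ω (b i) (b j) else 0
  have hB : ∀ i j, B (b i) (b j) = if i < j then ω (b i) (b j) else 0 := fun i j => by
    simp only [B, Module.Basis.constr_basis]
  have hneg : ∀ v w, ω v w = -ω w v := fun v w => by
    have h := hω (v + w)
    rw [map_add, map_add, LinearMap.add_apply, LinearMap.add_apply, hω, hω, zero_add,
      add_zero, add_comm] at h
    exact eq_neg_of_add_eq_zero_left h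
  refine ⟨B, fun v w => ?_, fun v w => ?_⟩
  · have : B - B.flip = ω := by
      refine b.ext fun i => b.ext fun j => ?_
      rw [LinearMap.sub_apply, LinearMap.sub_apply, LinearMap.flip_apply, hB, hB]
      rcases lt_trichotomy i j with h | rfl | h
      · rw [if_pos h, if_neg h.not_gt, sub_zero]
      · rw [if_neg (lt_irrefl _), sub_zero, hω]
      · rw [if_pos h, if_neg h.not_gt, zero_sub, hneg, neg_neg]
    rw [← this, LinearMap.sub_apply, LinearMap.sub_apply, LinearMap.flip_apply]
  · have : B.compr₂ (Submodule.span F {z | ∃ v w, ω v w = z}).mkQ = 0 := by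
      refine b.ext fun i => b.ext fun j => ?_
      rw [LinearMap.compr₂_apply, hB, LinearMap.zero_apply, LinearMap.zero_apply,
        Submodule.mkQ_apply, Submodule.Quotient.mk_eq_zero]
      split_ifs
      · exact Submodule.subset_span ⟨_, _, rfl⟩
      · exact zero_mem _
    rw [← Submodule.Quotient.mk_eq_zero, ← Submodule.mkQ_apply, ← LinearMap.compr₂_apply, this,
      LinearMap.zero_apply, LinearMap.zero_apply]

universe v w
variable {p : ℕ} {F : Type v} [Field F]
variable {L : Type w} [LieRing L] [LieAlgebra F L] [RestrictedLieAlgebra p F L]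

theorem mem_restrictedClosure {S : Set L} {x : L} : x ∈ restrictedClosure p F S ↔
    ∀ K : LieSubalgebra F L, S ⊆ K → (∀ x ∈ K, pmap p F L x ∈ K) → x ∈ K := by
  rw [restrictedClosure, ← SetLike.mem_coe, LieSubalgebra.coe_sInf]
  simp

theorem subset_restrictedClosure (S : Set L) : S ⊆ restrictedClosure p F S :=
  fun _ hx => mem_restrictedClosure.2 fun _ hK _ => hK hx

theorem pmap_mem_restrictedClosure {S : Set L} {x : L} (hx : x ∈ restrictedClosure p F S) :
    pmap p F L x ∈ restrictedClosure p F S :=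
  mem_restrictedClosure.2 fun K hS hK => hK _ (mem_restrictedClosure.1 hx K hS hK)

theorem restrictedClosure_le {S : Set L} {K : LieSubalgebra F L} (hS : S ⊆ K)
    (hK : ∀ x ∈ K, pmap p F L x ∈ K) : restrictedClosure p F S ≤ K :=
  sInf_le ⟨hS, hK⟩

theorem pmap_mem_subPPow {K : LieSubalgebra F L} {x : L} (hx : x ∈ K) :
    pmap p F L x ∈ subPPow p F K :=
  subset_restrictedClosure _ ⟨x, hx, rfl⟩

theorem IsPNilpotent.exists_iterate_pmap_eq_zero (hL : IsPNilpotent p F L) :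
    ∃ s, ∀ x : L, (pmap p F L)^[s] x = 0 := by
  obtain ⟨s, hs⟩ := hL
  have h : ∀ n (x : L), (pmap p F L)^[n] x ∈ (subPPow p F)^[n] (⊤ : LieSubalgebra F L) := by
    intro n x
    induction n with
    | zero => exact LieSubalgebra.mem_top x
    | succ n ih =>
      rw [Function.iterate_succ_apply', Function.iterate_succ_apply']
      exact pmap_mem_subPPow ih
  refine ⟨s, fun x => ?_⟩
  have := h s x
  rwa [hs, LieSubalgebra.mem_bot] at this

section LowerCentralSeries

theorem lie_mem_lowerCentralSeries_one (x y : L) :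
    ⁅x, y⁆ ∈ LieModule.lowerCentralSeries F L L 1 := by
  rw [LieModule.lowerCentralSeries_succ]
  exact LieSubmodule.lie_mem_lie (LieSubmodule.mem_top x) (LieSubmodule.mem_top y)

theorem lie_mem_lowerCentralSeries_two (x : L) {y : L}
    (hy : y ∈ LieModule.lowerCentralSeries F L L 1) :
    ⁅x, y⁆ ∈ LieModule.lowerCentralSeries F L L 2 := by
  rw [LieModule.lowerCentralSeries_succ F L L 1]
  exact LieSubmodule.lie_mem_lie (LieSubmodule.mem_top x) hy

theorem pmap_lie_mem_lowerCentralSeries_two [hp : Fact p.Prime] (x y : L) :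
    ⁅pmap p F L x, y⁆ ∈ LieModule.lowerCentralSeries F L L 2 := by
  have h : ∀ k, 2 ≤ k →
      (LieAlgebra.ad F L x ^ k) y ∈ LieModule.lowerCentralSeries F L L 2 := by
    intro k hk
    induction k, hk using Nat.le_induction with
    | base =>
      rw [pow_two]
      exact lie_mem_lowerCentralSeries_two x (lie_mem_lowerCentralSeries_one x y)
    | succ k _ ih =>
      rw [pow_succ']
      exact LieSubmodule.lie_mem _ ih
  rw [pmap, ad_pOp (p := p) (F := F) x y]
  exact h p hp.out.two_le

variable (F L) in
/-- The elements of `L` which are central modulo `γ₃(L)`. -/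
def centerModSeries : LieSubalgebra F L where
  carrier := {k | ∀ x, ⁅k, x⁆ ∈ LieModule.lowerCentralSeries F L L 2}
  add_mem' ha hb x := by rw [add_lie]; exact add_mem (ha x) (hb x)
  zero_mem' x := by rw [zero_lie]; exact zero_mem _
  smul_mem' c _ ha x := by rw [smul_lie]; exact SMulMemClass.smul_mem c (ha x)
  lie_mem' {a b} _ _ x := by
    rw [← lie_skew]
    exact neg_mem (lie_mem_lowerCentralSeries_two x (lie_mem_lowerCentralSeries_one a b))

theorem mem_centerModSeries_of_mem {x : L} (hx : x ∈ LieModule.lowerCentralSeries F L L 1) :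
    x ∈ centerModSeries F L := fun y => by
  rw [← lie_skew]
  exact neg_mem (lie_mem_lowerCentralSeries_two y hx)

theorem pmap_mem_centerModSeries [Fact p.Prime] (x : L) :
    pmap p F L x ∈ centerModSeries F L :=
  pmap_lie_mem_lowerCentralSeries_two x

theorem mainIdeal_le_centerModSeries [Fact p.Prime] :
    mainIdeal p F L ≤ (centerModSeries F L).toSubmodule := by
  refine sup_le ?_ fun x hx => mem_centerModSeries_of_mem
    (LieModule.antitone_lowerCentralSeries F L L one_le_two hx)
  refine restrictedClosure_le (K := centerModSeries F L) ?_ fun x _ => pmap_mem_centerModSeries x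
  rintro _ ⟨x, _, rfl⟩
  exact pmap_mem_centerModSeries x

theorem mkQ_mainIdeal_eq_zero {x : L} (hx : x ∈ LieModule.lowerCentralSeries F L L 2) :
    (mainIdeal p F L).mkQ x = 0 := by
  rw [Submodule.mkQ_apply, Submodule.Quotient.mk_eq_zero]
  exact Submodule.mem_sup_right hx

/-- The bracket of `L/(L'^p + γ₃(L))` is the antisymmetrization of a bilinear map with the same
kernel and image. -/
theorem exists_bilinear_sub_eq_lie [Fact p.Prime] :
    ∃ B : (L ⧸ mainIdeal p F L) →ₗ[F] (L ⧸ mainIdeal p F L) →ₗ[F] (L ⧸ mainIdeal p F L),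
      (∀ x y, B ((mainIdeal p F L).mkQ x) ((mainIdeal p F L).mkQ y)
        - B ((mainIdeal p F L).mkQ y) ((mainIdeal p F L).mkQ x) = (mainIdeal p F L).mkQ ⁅x, y⁆) ∧
      (∀ z ∈ centerModSeries F L, ∀ n, B ((mainIdeal p F L).mkQ z) n = 0 ∧
        B n ((mainIdeal p F L).mkQ z) = 0) ∧
      ∀ m n, B m n ∈ Submodule.span F {z | ∃ m n, B m n - B n m = z} := by
  set D := mainIdeal p F L with hD
  let Z := (centerModSeries F L).toSubmodule
  obtain ⟨l, hl⟩ := Z.mkQ.exists_rightInverse_of_surjective Z.range_mkQ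
  have hl' : ∀ x, x - l (Z.mkQ x) ∈ Z := fun x => by
    have := LinearMap.congr_fun hl (Z.mkQ x)
    rw [LinearMap.comp_apply, LinearMap.id_apply] at this
    rw [← Submodule.Quotient.mk_eq_zero, ← Submodule.mkQ_apply, map_sub, this, sub_self]
  let ω : (L ⧸ Z) →ₗ[F] (L ⧸ Z) →ₗ[F] (L ⧸ D) :=
    ((LieModule.toEnd F L L).toLinearMap.compr₂ D.mkQ).compl₁₂ l l
  have hω : ∀ v w, ω v w = D.mkQ ⁅l v, l w⁆ := fun v w => rfl
  have hωmk : ∀ x y, ω (Z.mkQ x) (Z.mkQ y) = D.mkQ ⁅x, y⁆ := by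
    intro x y
    have h1 : D.mkQ ⁅x - l (Z.mkQ x), y⁆ = 0 := mkQ_mainIdeal_eq_zero (hl' x y)
    have h2 : D.mkQ ⁅l (Z.mkQ x), y - l (Z.mkQ y)⁆ = 0 := by
      rw [← lie_skew, map_neg, mkQ_mainIdeal_eq_zero (hl' y _), neg_zero]
    rw [sub_lie, map_sub, sub_eq_zero] at h1
    rw [lie_sub, map_sub, sub_eq_zero] at h2
    rw [hω, h1, h2]
  obtain ⟨B, hBω, hB⟩ := LinearMap.exists_sub_flip_eq (ω := ω) fun v => by
    rw [hω, lie_self, map_zero]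
  let g : (L ⧸ D) →ₗ[F] (L ⧸ Z) := D.mapQ Z LinearMap.id mainIdeal_le_centerModSeries
  have hg : ∀ x, g (D.mkQ x) = Z.mkQ x := fun x => rfl
  refine ⟨B.compl₁₂ g g, fun x y => ?_, fun z hz n => ?_, fun m n => ?_⟩
  · simp only [LinearMap.compl₁₂_apply, hg, hBω, hωmk]
  · have : Z.mkQ z = 0 := by rwa [Submodule.mkQ_apply, Submodule.Quotient.mk_eq_zero]
    simp only [LinearMap.compl₁₂_apply, hg, this, map_zero, LinearMap.zero_apply, and_self]
  · refine Submodule.span_mono ?_ (hB (g m) (g n))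
    rintro _ ⟨v, w, rfl⟩
    obtain ⟨x, rfl⟩ := Z.mkQ_surjective v
    obtain ⟨y, rfl⟩ := Z.mkQ_surjective w
    exact ⟨D.mkQ x, D.mkQ y, by simp only [LinearMap.compl₁₂_apply, hg, hBω]⟩

end LowerCentralSeries

/-- The failure of additivity of the `p`-map in a quotient of nilpotency class two. -/
theorem map_pmap_add [Fact p.Prime] {N : Type*} [AddCommGroup N] [Module F N] (π : L →ₗ[F] N)
    (B : N →ₗ[F] N →ₗ[F] N) (hlie : ∀ x y, B (π x) (π y) - B (π y) (π x) = π ⁅x, y⁆)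
    (hleft : ∀ x y z, B (B x y) z = 0) (hright : ∀ x y z, B x (B y z) = 0) (x y : L) :
    π (pmap p F L (x + y)) - π (pmap p F L x) - π (pmap p F L y)
      = (if p = 2 then B (π (x + y)) (π (x + y)) else 0)
        - (if p = 2 then B (π x) (π x) else 0) - (if p = 2 then B (π y) (π y) else 0) := by
  have hp : p.Prime := Fact.out
  let T : N →ₗ[F] Module.End F (F × N) := LinearMap.mk₂ F (fun v g => (0, g.1 • v + B v g.2))
    (fun a b g => by
      simp only [map_add, LinearMap.add_apply, smul_add, Prod.mk_add_mk, add_zero]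
      congr 1; abel)
    (fun c a g => by
      simp only [map_smul, LinearMap.smul_apply, smul_add, Prod.smul_mk, smul_zero,
        smul_comm c])
    (fun a g h => by
      simp only [map_add, Prod.fst_add, Prod.snd_add, add_smul, Prod.mk_add_mk, add_zero]
      congr 1; abel)
    (fun c a g => by
      simp only [map_smul, Prod.smul_fst, Prod.smul_snd, smul_add, Prod.smul_mk, smul_zero,
        smul_assoc])
  have hT : ∀ v g, T v g = (0, g.1 • v + B v g.2) := fun v g => rfl
  have hTT : ∀ v w g, T v (T w g) = (0, g.1 • B v w) := fun v w g => by
    simp only [hT, zero_smul, zero_add, map_add, map_smul, hright, add_zero]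
  let θ : L →ₗ⁅F⁆ Module.End F (F × N) := { T.comp π with
    map_lie' := fun {x y} => by
      refine LinearMap.ext fun g => ?_
      rw [LieRing.of_associative_ring_bracket, LinearMap.sub_apply, Module.End.mul_apply,
        Module.End.mul_apply]
      change T (π ⁅x, y⁆) g = T (π x) (T (π y) g) - T (π y) (T (π x) g)
      rw [hTT, hTT, hT, ← hlie, map_sub, LinearMap.sub_apply, hleft, hleft, sub_zero, add_zero,
        Prod.mk_sub_mk, sub_zero, smul_sub] }
  have hθ : ∀ x, θ x = T (π x) := fun x => rfl
  have hpow : ∀ v, (T v ^ p) (1, 0) = (0, if p = 2 then B v v else 0) := by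
    intro v
    obtain ⟨k, hk⟩ := Nat.exists_eq_add_of_le' hp.two_le
    have h2 : (T v ^ p) (1, 0) = (T v ^ k) (0, B v v) := by
      rw [hk, pow_add, pow_two, Module.End.mul_apply, Module.End.mul_apply, hTT, one_smul]
    rw [h2]
    cases k with
    | zero => rw [if_pos (by omega), pow_zero, Module.End.one_apply]
    | succ k =>
      rw [if_neg (by omega), pow_succ, Module.End.mul_apply, hT, zero_smul, hright, add_zero]
      exact map_zero _
  have h := congrArg (fun u => UniversalEnvelopingAlgebra.lift F θ u (1, 0))
    (pOp_add (p := p) (F := F) x y)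
  simp only [← map_add, map_sub, map_pow, lift_ι_apply, hθ, LinearMap.sub_apply, hpow] at h
  simpa only [hT, one_smul, map_zero, add_zero, Prod.mk_sub_mk, sub_zero, Prod.mk.injEq,
    true_and] using h

/-- The quotient `L/(L'^p + γ₃(L))` of a `p`-nilpotent restricted Lie algebra comes from a
Frobenius twist. -/
theorem IsPNilpotent.exists_frobeniusTwist [Fact p.Prime] [CharP F p] (hL : IsPNilpotent p F L) :
    ∃ t : FrobeniusTwist p F (L ⧸ mainIdeal p F L),
      t.IsRestrictedHom (mainIdeal p F L).mkQ := by
  obtain ⟨B, hlie, hker, hmem⟩ := exists_bilinear_sub_eq_lie (p := p) (F := F) (L := L)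
  set π := (mainIdeal p F L).mkQ
  have hsurj : ∀ n, ∃ x, π x = n := Submodule.mkQ_surjective _
  have hπ : ∀ x ∈ mainIdeal p F L, π x = 0 := fun x hx => by
    rwa [Submodule.mkQ_apply, Submodule.Quotient.mk_eq_zero]
  have hBlcs : ∀ m n, ∃ x ∈ LieModule.lowerCentralSeries F L L 1, B m n = π x := by
    intro m n
    have hle : Submodule.span F {z | ∃ m n, B m n - B n m = z} ≤
        (LieModule.lowerCentralSeries F L L 1).toSubmodule.map π := by
      rw [Submodule.span_le]
      rintro _ ⟨m, n, rfl⟩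
      obtain ⟨x, rfl⟩ := hsurj m
      obtain ⟨y, rfl⟩ := hsurj n
      exact ⟨_, lie_mem_lowerCentralSeries_one x y, (hlie x y).symm⟩
    obtain ⟨x, hx, h⟩ := hle (hmem m n)
    exact ⟨x, hx, h.symm⟩
  have hleft : ∀ x y z, B (B x y) z = 0 := fun x y z => by
    obtain ⟨w, hw, h⟩ := hBlcs x y
    rw [h, (hker w (mem_centerModSeries_of_mem hw) z).1]
  have hright : ∀ x y z, B x (B y z) = 0 := fun x y z => by
    obtain ⟨w, hw, h⟩ := hBlcs y z
    rw [h, (hker w (mem_centerModSeries_of_mem hw) x).2]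
  let β : L ⧸ mainIdeal p F L → L ⧸ mainIdeal p F L := fun v => if p = 2 then B v v else 0
  have hβsmul : ∀ (c : F) v, β (c • v) = c ^ p • β v := fun c v => by
    simp only [β]
    split_ifs with h
    · have hc : c ^ p = c * c := by rw [← pow_two]; exact congrArg (c ^ ·) h
      rw [map_smul, map_smul, LinearMap.smul_apply, smul_smul, hc]
    · rw [smul_zero]
  have hβker : ∀ z ∈ centerModSeries F L, β (π z) = 0 := fun z hz => by
    simp only [β, (hker z hz _).1, ite_self]
  have hβlcs : ∀ v, ∃ x ∈ LieModule.lowerCentralSeries F L L 1, β v = π x := by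
    intro v
    simp only [β]
    split_ifs
    · exact hBlcs v v
    · exact ⟨0, zero_mem _, (map_zero _).symm⟩
  let f₀ : L →ₛₗ[frobenius F p] (L ⧸ mainIdeal p F L) :=
    { toFun := fun x => π (pmap p F L x) - β (π x)
      map_add' := fun x y => by
        have h := map_pmap_add (p := p) π B hlie hleft hright x y
        change _ = β (π (x + y)) - β (π x) - β (π y) at h
        rw [← sub_eq_zero] at h ⊢
        rw [← h]
        abel
      map_smul' := fun c x => by
        rw [map_smul, hβsmul, pmap, pOp_smul, map_smul, frobenius_def, smul_sub] }
  have hf₀ : ∀ x, f₀ x = π (pmap p F L x) - β (π x) := fun x => rfl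
  have hf₀one : ∀ x ∈ LieModule.lowerCentralSeries F L L 1, f₀ x = 0 := fun x hx => by
    rw [hf₀, hβker x (mem_centerModSeries_of_mem hx), sub_zero, hπ]
    exact Submodule.mem_sup_left (pmap_mem_subPPow (subset_restrictedClosure _ hx))
  have hf₀ker : mainIdeal p F L ≤ LinearMap.ker f₀ := by
    refine sup_le (fun x hx => ?_) fun x hx => hf₀one x
      (LieModule.antitone_lowerCentralSeries F L L one_le_two hx)
    rw [LinearMap.mem_ker, hf₀,
      hβker x (mainIdeal_le_centerModSeries (Submodule.mem_sup_left hx)), sub_zero, hπ]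
    exact Submodule.mem_sup_left (pmap_mem_restrictedClosure hx)
  let f : (L ⧸ mainIdeal p F L) →ₛₗ[frobenius F p] (L ⧸ mainIdeal p F L) := (mainIdeal p F L).liftQ f₀ hf₀ker
  have hf : ∀ x, f (π x) = π (pmap p F L x) - β (π x) := fun x => rfl
  have hflcs : ∀ x ∈ LieModule.lowerCentralSeries F L L 1, f (π x) = 0 := hf₀one
  have hfβ : ∀ v, f (β v) = 0 := fun v => by
    obtain ⟨x, hx, h⟩ := hβlcs v
    rw [h, hflcs x hx]
  have hBf : ∀ m n, B (f m) n = 0 ∧ B n (f m) = 0 := by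
    intro m n
    obtain ⟨x, rfl⟩ := hsurj m
    obtain ⟨y, hy, h⟩ := hβlcs (π x)
    rw [hf, h, ← map_sub]
    exact hker _ (sub_mem (pmap_mem_centerModSeries x) (mem_centerModSeries_of_mem hy)) n
  have hiter : ∀ k x, f^[k + 1] (π x) = f (π ((pmap p F L)^[k] x)) := by
    intro k
    induction k with
    | zero => intro x; rfl
    | succ k ih =>
      intro x
      rw [Function.iterate_succ_apply', ih, hf, map_sub, hfβ, sub_zero,
        ← Function.iterate_succ_apply' (pmap p F L)]
  obtain ⟨s, hs⟩ := hL.exists_iterate_pmap_eq_zero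
  refine ⟨⟨B, f, hleft, hright, fun x y => (hBf x y).1, fun x y => (hBf y x).2, fun x y => ?_,
    ⟨s + 1, fun n => ?_⟩, hmem⟩, fun x y => (hlie x y).symm, fun x => ?_⟩
  · obtain ⟨w, hw, h⟩ := hBlcs x y
    rw [h, hflcs w hw]
  · obtain ⟨x, rfl⟩ := hsurj n
    rw [hiter, hs, map_zero, map_zero]
  · exact (sub_add_cancel (π (pmap p F L x)) (β (π x))).symm

end Twist

section Comparison

universe u v w w'

variable {p : ℕ} {F : Type v} [Field F] [Fact p.Prime]
  {L : Type w} [LieRing L] [LieAlgebra F L] [RestrictedLieAlgebra p F L]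
  {H : Type w'} [LieRing H] [LieAlgebra F H] [RestrictedLieAlgebra p F H]

theorem sub_algebraMap_aug_mem (u : uEnv p F L) :
    u - algebraMap F _ (aug p F L u) ∈ LinearMap.range (uemb p F L) ⊔
      Submodule.span F {z | ∃ a b, aug p F L a = 0 ∧ aug p F L b = 0 ∧ a * b = z} := by
  induction u using uEnv_induction with
  | algebraMap c => simp
  | uemb x =>
    rw [aug_uemb, map_zero, sub_zero]
    exact Submodule.mem_sup_left ⟨x, rfl⟩
  | add a b ha hb =>
    rw [map_add, map_add, add_sub_add_comm]
    exact add_mem ha hb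
  | mul a b ha hb =>
    have hab : a * b - algebraMap F _ (aug p F L (a * b)) =
        (a - algebraMap F _ (aug p F L a)) * (b - algebraMap F _ (aug p F L b))
        + aug p F L b • (a - algebraMap F _ (aug p F L a))
        + aug p F L a • (b - algebraMap F _ (aug p F L b)) := by
      simp only [Algebra.algebraMap_eq_smul_one, map_mul, mul_sub, sub_mul, smul_sub,
        smul_mul_assoc, mul_smul_comm, one_mul, mul_one, smul_smul,
        mul_comm (aug p F L b) (aug p F L a)]
      abel
    rw [hab]
    refine add_mem (add_mem (Submodule.mem_sup_right (Submodule.subset_span ⟨_, _, ?_, ?_, rfl⟩))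
      (Submodule.smul_mem _ _ ha)) (Submodule.smul_mem _ _ hb) <;> simp

/-- Algebra homomorphisms between restricted enveloping algebras preserve the augmentation, if the
source is `p`-nilpotent. -/
theorem IsPNilpotent.aug_map (hL : IsPNilpotent p F L) (φ : uEnv p F L →ₐ[F] uEnv p F H)
    (u : uEnv p F L) : aug p F H (φ u) = aug p F L u := by
  obtain ⟨s, hs⟩ := hL.exists_iterate_pmap_eq_zero
  have hiter : ∀ k x, uemb p F L ((pmap p F L)^[k] x) = uemb p F L x ^ p ^ k := by
    intro k x
    induction k with
    | zero => simp
    | succ k ih => rw [Function.iterate_succ_apply', uemb_pmap, ih, ← pow_mul, pow_succ]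
  induction u using uEnv_induction with
  | algebraMap c => simp
  | uemb x =>
    have h : aug p F H (φ (uemb p F L x)) ^ p ^ s = 0 := by
      rw [← map_pow, ← map_pow, ← hiter, hs, map_zero, map_zero, map_zero]
    rw [aug_uemb, eq_zero_of_pow_eq_zero h]
  | add a b ha hb => rw [map_add, map_add, map_add, ha, hb]
  | mul a b ha hb => rw [map_mul, map_mul, map_mul, ha, hb]

variable [CharP F p] {N : Type u} [AddCommGroup N] [Module F N]

namespace FrobeniusTwist

variable {t : FrobeniusTwist p F N}

theorem B_eq_zero_of_mem_derived {z : N} (hz : z ∈ t.derived) (x : N) :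
    t.B z x = 0 ∧ t.B x z = 0 := by
  have h : t.derived ≤ LinearMap.ker (t.B.flip x) ⊓ LinearMap.ker (t.B x) := by
    rw [derived, Submodule.span_le]
    rintro _ ⟨y, z, rfl⟩
    constructor
    · simp [br, t.B_B_left]
    · simp [br, t.B_B_right]
  exact h hz

theorem B_eq_zero_of_mem_derived_sup_range [PerfectField F] {z : N}
    (hz : z ∈ t.derived ⊔ LinearMap.range t.f) (x : N) : t.B z x = 0 ∧ t.B x z = 0 := by
  obtain ⟨a, ha, _, ⟨y, rfl⟩, rfl⟩ := Submodule.mem_sup.1 hz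
  obtain ⟨h1, h2⟩ := B_eq_zero_of_mem_derived ha x
  rw [map_add, map_add, LinearMap.add_apply, h1, h2, t.B_f_left, t.B_f_right, add_zero]
  exact ⟨rfl, rfl⟩

theorem f_eq_zero_of_mem_derived {z : N} (hz : z ∈ t.derived) : t.f z = 0 := by
  have h : t.derived ≤ LinearMap.ker t.f := by
    rw [derived, Submodule.span_le]
    rintro _ ⟨y, z, rfl⟩
    rw [SetLike.mem_coe, LinearMap.mem_ker, br, map_sub, t.f_B, t.f_B, sub_zero]
  exact h hz

theorem pw_sub_f_mem_derived (z : N) : t.pw z - t.f z ∈ t.derived := by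
  rw [pw, add_sub_cancel_left]
  split_ifs
  · exact t.B_mem z z
  · exact zero_mem _

namespace IsRestrictedHom

variable {Φ : L →ₗ[F] N}

theorem map_mem_derived (hΦ : t.IsRestrictedHom Φ) {x : L}
    (hx : x ∈ LieModule.lowerCentralSeries F L L 1) : Φ x ∈ t.derived := by
  rw [LieModule.lowerCentralSeries_succ, ← LieSubmodule.mem_toSubmodule,
    LieSubmodule.lieIdeal_oper_eq_linear_span'] at hx
  have : Submodule.span F {⁅x, n⁆ | (x ∈ (⊤ : LieIdeal F L))
      (n ∈ LieModule.lowerCentralSeries F L L 0)} ≤ t.derived.comap Φ := by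
    rw [Submodule.span_le]
    rintro _ ⟨y, -, z, -, rfl⟩
    rw [SetLike.mem_coe, Submodule.mem_comap, hΦ.map_lie]
    exact Submodule.subset_span ⟨_, _, rfl⟩
  exact this hx

theorem mainIdeal_le_ker (hΦ : t.IsRestrictedHom Φ) : mainIdeal p F L ≤ LinearMap.ker Φ := by
  have hp0 : ∀ y, Φ (pmap p F L y) = t.f (Φ y) + if p = 2 then t.B (Φ y) (Φ y) else 0 :=
    hΦ.map_pmap
  let K : LieSubalgebra F L :=
    { carrier := {y | (∀ x, t.B (Φ y) x = 0) ∧ (∀ x, t.B x (Φ y) = 0) ∧ t.f (Φ y) = 0}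
      add_mem' := fun ⟨h1, h2, h3⟩ ⟨h4, h5, h6⟩ => by
        simp [h1, h2, h3, h4, h5, h6]
      zero_mem' := by simp
      smul_mem' := fun c y ⟨h1, h2, h3⟩ => by
        simp [h1, h2, h3]
      lie_mem' := fun {y z} ⟨h1, h2, _⟩ _ => by
        simp [hΦ.map_lie, br, h1, h2] }
  let M : LieSubalgebra F L :=
    { LinearMap.ker Φ with
      lie_mem' := fun {y z} hy hz => by
        have hy : Φ y = 0 := hy
        have hz : Φ z = 0 := hz
        change Φ ⁅y, z⁆ = 0
        simp [hΦ.map_lie, br, hy, hz] }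
  have hKM : ∀ y ∈ K, pmap p F L y ∈ M := by
    rintro y ⟨h1, -, h3⟩
    change Φ (pmap p F L y) = 0
    rw [hp0, h3, h1, ite_self, add_zero]
  have hMK : M ≤ K := fun y hy => by
    have hy : Φ y = 0 := hy
    exact ⟨by simp [hy], by simp [hy], by simp [hy]⟩
  have hK : restrictedClosure p F (derivedSub F L : Set L) ≤ K := by
    refine restrictedClosure_le (fun y hy => ?_) fun y hy => hMK (hKM y hy)
    have h := hΦ.map_mem_derived hy
    have h' := B_eq_zero_of_mem_derived h
    exact ⟨fun x => (h' x).1, fun x => (h' x).2, f_eq_zero_of_mem_derived h⟩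
  refine sup_le ?_ fun y hy => ?_
  · have : subPPow p F (restrictedClosure p F (derivedSub F L : Set L)) ≤ M := by
      refine restrictedClosure_le ?_ fun y hy => hKM y (hMK hy)
      rintro _ ⟨y, hy, rfl⟩
      exact hKM y (hK hy)
    exact this
  · rw [LieModule.lowerCentralSeries_succ, LieSubmodule.lieIdeal_oper_eq_linear_span'] at hy
    refine (Submodule.span_le.2 ?_) hy
    rintro _ ⟨y, -, z, hz, rfl⟩
    have h := B_eq_zero_of_mem_derived (hΦ.map_mem_derived hz) (Φ y)
    rw [SetLike.mem_coe, LinearMap.mem_ker, hΦ.map_lie, br, h.1, h.2, sub_zero]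

theorem surjective_of_forall_exists_sub_mem [PerfectField F] (hΦ : t.IsRestrictedHom Φ)
    (h : ∀ n, ∃ x, n - Φ x ∈ t.derived ⊔ LinearMap.range t.f) : Function.Surjective Φ := by
  have hder : t.derived ≤ LinearMap.range Φ := by
    rw [derived, Submodule.span_le]
    rintro _ ⟨m, n, rfl⟩
    obtain ⟨x, hx⟩ := h m
    obtain ⟨y, hy⟩ := h n
    refine ⟨⁅x, y⁆, ?_⟩
    have h1 := B_eq_zero_of_mem_derived_sup_range hx
    have h2 := B_eq_zero_of_mem_derived_sup_range hy
    have h3 : ∀ z, t.B m z = t.B (Φ x) z := fun z => by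
      rw [← sub_eq_zero, ← LinearMap.sub_apply, ← map_sub, (h1 z).1]
    have h4 : ∀ z, t.B z m = t.B z (Φ x) := fun z => by
      rw [← sub_eq_zero, ← map_sub, (h1 z).2]
    have h5 : ∀ z, t.B n z = t.B (Φ y) z := fun z => by
      rw [← sub_eq_zero, ← LinearMap.sub_apply, ← map_sub, (h2 z).1]
    have h6 : ∀ z, t.B z n = t.B z (Φ y) := fun z => by
      rw [← sub_eq_zero, ← map_sub, (h2 z).2]
    rw [hΦ.map_lie, br, br, h3, h4, h5, h6]
  have hf : ∀ x, t.f (Φ x) ∈ LinearMap.range Φ := fun x => by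
    have := sub_mem (⟨pmap p F L x, rfl⟩ : Φ (pmap p F L x) ∈ LinearMap.range Φ)
      (hder (pw_sub_f_mem_derived (t := t) (Φ x)))
    rwa [hΦ.map_pmap, sub_sub_cancel] at this
  have key : ∀ k n, ∃ m, n - t.f^[k] m ∈ LinearMap.range Φ := by
    intro k
    induction k with
    | zero => exact fun n => ⟨n, by simp⟩
    | succ k ih =>
      intro n
      obtain ⟨x, hx⟩ := h n
      obtain ⟨a, ha, _, ⟨m, rfl⟩, hsum⟩ := Submodule.mem_sup.1 hx
      obtain ⟨m', y, hy⟩ := ih m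
      refine ⟨m', ?_⟩
      rw [Function.iterate_succ_apply']
      have : n - t.f (t.f^[k] m') = Φ x + a + t.f (Φ y) := by
        rw [hy, map_sub, ← add_sub_assoc, add_assoc, hsum, add_sub_cancel]
      rw [this]
      exact add_mem (add_mem ⟨x, rfl⟩ (hder ha)) (hf y)
  obtain ⟨k, hk⟩ := t.exists_iterate_eq_zero
  intro n
  obtain ⟨m, hm⟩ := key k n
  rwa [hk, sub_zero] at hm

end IsRestrictedHom

end FrobeniusTwist

/-- An isomorphism `u(L) ≃ u(H)` turns a surjective restricted homomorphism from `H` onto a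
Frobenius twist into one from `L`. -/
theorem exists_surjective_isRestrictedHom [PerfectField F] (hL : IsPNilpotent p F L)
    (φ : uEnv p F L ≃ₐ[F] uEnv p F H) (t : FrobeniusTwist p F N)
    {π : H →ₗ[F] N} (hπ : t.IsRestrictedHom π) (hsurj : Function.Surjective π) :
    ∃ Φ : L →ₗ[F] N, t.IsRestrictedHom Φ ∧ Function.Surjective Φ := by
  obtain ⟨ρ, hρ, hbr, hmul, hpw⟩ := t.exists_extension hπ
  have hφ : ∀ u, aug p F H (φ u) = aug p F L u := hL.aug_map φ.toAlgHom
  have hφx : ∀ x, aug p F H (φ (uemb p F L x)) = 0 := fun x => by rw [hφ, aug_uemb]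
  let Φ : L →ₗ[F] N := ρ ∘ₗ φ.toLinearMap ∘ₗ uemb p F L
  have hΦ : ∀ x, Φ x = ρ (φ (uemb p F L x)) := fun x => rfl
  have hrest : t.IsRestrictedHom Φ := by
    refine ⟨fun x y => ?_, fun x => ?_⟩
    · simp only [hΦ]
      rw [uemb_lie, map_sub, map_mul, map_mul, hbr _ _ (hφx x) (hφx y)]
    · simp only [hΦ]
      rw [uemb_pmap, map_pow, hpw _ (hφx x)]
  refine ⟨Φ, hrest, hrest.surjective_of_forall_exists_sub_mem fun n => ?_⟩
  obtain ⟨y, rfl⟩ := hsurj n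
  have haug : aug p F L (φ.symm (uemb p F H y)) = 0 := by
    rw [← hφ, AlgEquiv.apply_symm_apply, aug_uemb]
  have hmem := sub_algebraMap_aug_mem (φ.symm (uemb p F H y))
  rw [haug, map_zero, sub_zero] at hmem
  obtain ⟨_, ⟨x, rfl⟩, b, hb, hsum⟩ := Submodule.mem_sup.1 hmem
  refine ⟨x, ?_⟩
  have hdiff : π y - Φ x = ρ (φ b) := by
    rw [hΦ, ← hρ, ← map_sub, ← φ.apply_symm_apply (uemb p F H y), ← map_sub, ← hsum,
      add_sub_cancel_left]
  rw [hdiff]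
  have hle : Submodule.span F {z | ∃ a b, aug p F L a = 0 ∧ aug p F L b = 0 ∧ a * b = z} ≤
      (t.derived ⊔ LinearMap.range t.f).comap (ρ ∘ₗ φ.toLinearMap) := by
    rw [Submodule.span_le]
    rintro _ ⟨a, b, ha, hb, rfl⟩
    rw [SetLike.mem_coe, Submodule.mem_comap, LinearMap.comp_apply, AlgEquiv.toLinearMap_apply,
      map_mul]
    exact hmul _ _ ((hφ a).trans ha) ((hφ b).trans hb)
  exact hle hb

/-- An isomorphism `u(L) ≃ u(H)` yields a surjective restricted homomorphism from
`L/(L'^p + γ₃(L))` to `H/(H'^p + γ₃(H))`. -/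
theorem exists_surjective_quotient [PerfectField F] (hL : IsPNilpotent p F L)
    (φ : uEnv p F L ≃ₐ[F] uEnv p F H)
    (t : FrobeniusTwist p F (H ⧸ mainIdeal p F H)) (ht : t.IsRestrictedHom (mainIdeal p F H).mkQ) :
    ∃ e : (L ⧸ mainIdeal p F L) →ₗ[F] (H ⧸ mainIdeal p F H), Function.Surjective e ∧
      t.IsRestrictedHom (e ∘ₗ (mainIdeal p F L).mkQ) := by
  obtain ⟨Φ, hΦ, hsurj⟩ :=
    exists_surjective_isRestrictedHom hL φ t ht (Submodule.mkQ_surjective _)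
  refine ⟨(mainIdeal p F L).liftQ Φ hΦ.mainIdeal_le_ker, fun n => ?_, ?_⟩
  · obtain ⟨x, rfl⟩ := hsurj n
    exact ⟨(mainIdeal p F L).mkQ x, rfl⟩
  · rwa [Submodule.liftQ_mkQ]

end Comparison

end RestrictedLieAlgebra

open RestrictedLieAlgebra in
/-- **Main Theorem.** If `L` and `H` are finite-dimensional `p`-nilpotent restricted Lie
algebras over a perfect field `F` of characteristic `p > 0` and `u(L) ≅ u(H)` as
`F`-algebras, then `L/(L'^p + γ₃(L)) ≅ H/(H'^p + γ₃(H))` as restricted Lie algebras. -/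
theorem main_quotient_determined
    (p : ℕ) (F L H : Type*) [Field F] [Fact p.Prime] [CharP F p] [PerfectField F]
    [LieRing L] [LieAlgebra F L] [RestrictedLieAlgebra p F L]
    [LieRing H] [LieAlgebra F H] [RestrictedLieAlgebra p F H]
    [FiniteDimensional F L] [FiniteDimensional F H]
    (hL : IsPNilpotent p F L) (hH : IsPNilpotent p F H)
    (hiso : Nonempty (uEnv p F L ≃ₐ[F] uEnv p F H)) :
    -- `L/(L'^p + γ₃(L)) ≅ H/(H'^p + γ₃(H))` as restricted Lie algebras:
    ∃ e : (L ⧸ mainIdeal p F L) ≃ₗ[F] (H ⧸ mainIdeal p F H),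
      ∀ (x x' : L) (y y' : H),
        e (Submodule.Quotient.mk x) = Submodule.Quotient.mk y →
        e (Submodule.Quotient.mk x') = Submodule.Quotient.mk y' →
        e (Submodule.Quotient.mk ⁅x, x'⁆) = Submodule.Quotient.mk ⁅y, y'⁆ ∧
        e (Submodule.Quotient.mk (pmap p F L x)) = Submodule.Quotient.mk (pmap p F H y) := by
  obtain ⟨φ⟩ := hiso
  obtain ⟨t, ht⟩ := hH.exists_frobeniusTwist
  obtain ⟨t', ht'⟩ := hL.exists_frobeniusTwist
  obtain ⟨e, hsurj, he⟩ := exists_surjective_quotient hL φ t ht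
  obtain ⟨e', hsurj', -⟩ := exists_surjective_quotient hH φ.symm t' ht'
  have hrank : Module.finrank F (L ⧸ mainIdeal p F L) = Module.finrank F (H ⧸ mainIdeal p F H) :=
    le_antisymm (LinearMap.finrank_le_finrank_of_surjective hsurj')
      (LinearMap.finrank_le_finrank_of_surjective hsurj)
  have hinj := (LinearMap.injective_iff_surjective_of_finrank_eq_finrank hrank).2 hsurj
  refine ⟨LinearEquiv.ofBijective e ⟨hinj, hsurj⟩, fun x x' y y' hx hx' => ?_⟩
  have hx : e ((mainIdeal p F L).mkQ x) = (mainIdeal p F H).mkQ y := hx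
  have hx' : e ((mainIdeal p F L).mkQ x') = (mainIdeal p F H).mkQ y' := hx'
  have h1 := he.map_lie x x'
  have h2 := he.map_pmap x
  simp only [LinearMap.comp_apply] at h1 h2
  rw [hx, hx', ← ht.map_lie] at h1
  rw [hx, ← ht.map_pmap] at h2
  exact ⟨h1, h2⟩
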